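/- arXiv:1108.0474 — 2 statements merged into one kernel-verified Lean document; each statement's English description precedes it below -/
import Mathlib

section
/- Let n ≥ 1 and let P be a nonempty σ-compact Hausdorff topological space. Suppose that for every compact subset X of P there is an open topological embedding f : ℝⁿ → P (an open embedding of the standard open ball) such that X ⊆ f(ℝⁿ). Then P is homeomorphic to ℝⁿ. -/
open Set Filter Topology Metric

/-- The piecewise linear order automorphism of `ℝ` that is the identity up to `c` and has slope
`k` beyond `c`. -/
noncomputable def kinkOrderIso (c k : ℝ) (hk : 0 < k) : ℝ ≃o ℝ :=
  StrictMono.orderIsoOfRightInverse (fun t => t + (k - 1) * max (t - c) 0)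
    (by
      intro s t hst
      rcases le_or_gt (s - c) 0 with h | h <;> rcases le_or_gt (t - c) 0 with h' | h' <;>
        simp only [h, h', max_eq_right, max_eq_left_of_lt] <;>
        nlinarith [mul_pos hk (sub_pos.2 hst)])
    (fun t => t + (k⁻¹ - 1) * max (t - c) 0)
    (by
      intro t
      rcases le_total (t - c) 0 with h | h
      · simp [h]
      · have h0 : t + (k⁻¹ - 1) * (t - c) - c = k⁻¹ * (t - c) := by ring
        have h1 : 0 ≤ k⁻¹ * (t - c) := by positivity
        simp only [h, max_eq_left, h0, h1]
        field_simp
        ring)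

theorem kinkOrderIso_of_le {c k t : ℝ} (hk : 0 < k) (h : t ≤ c) : kinkOrderIso c k hk t = t := by
  have : t - c ≤ 0 := by linarith
  change t + (k - 1) * max (t - c) 0 = t
  simp [this]

theorem kinkOrderIso_of_ge {c k t : ℝ} (hk : 0 < k) (h : c ≤ t) :
    kinkOrderIso c k hk t = c + k * (t - c) := by
  have : 0 ≤ t - c := by linarith
  change t + (k - 1) * max (t - c) 0 = _
  rw [max_eq_left this]
  ring

theorem exists_orderIso_real_eq_id_off_Icc {δ a b R : ℝ} (ha : δ < a) (hb : δ < b) (haR : a < R)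
    (hbR : b < R) :
    ∃ u : ℝ ≃o ℝ, (∀ t ≤ δ, u t = t) ∧ (∀ t, R ≤ t → u t = t) ∧ u a = b := by
  have ha' : 0 < a - δ := by linarith
  have hb' : 0 < b - δ := by linarith
  have haR' : 0 < R - a := by linarith
  have hbR' : 0 < R - b := by linarith
  have h₁ : 0 < (b - δ) / (a - δ) := by positivity
  have h₂ : 0 < ((R - b) / (R - a)) / ((b - δ) / (a - δ)) := by positivity
  have h₃ : 0 < (R - a) / (R - b) := by positivity
  refine ⟨((kinkOrderIso δ _ h₁).trans (kinkOrderIso b _ h₂)).trans (kinkOrderIso R _ h₃),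
    ?_, ?_, ?_⟩
  · intro t ht
    simp only [OrderIso.trans_apply]
    rw [kinkOrderIso_of_le h₁ ht, kinkOrderIso_of_le h₂ (by linarith),
      kinkOrderIso_of_le h₃ (by linarith)]
  · intro t ht
    simp only [OrderIso.trans_apply]
    have e₁ : kinkOrderIso δ _ h₁ t = b + (b - δ) / (a - δ) * (t - a) := by
      rw [kinkOrderIso_of_ge h₁ (by linarith)]
      field_simp
      ring
    have e₂ : kinkOrderIso b _ h₂ (b + (b - δ) / (a - δ) * (t - a)) =
        R + (R - b) / (R - a) * (t - R) := by
      rw [kinkOrderIso_of_ge h₂ (le_add_of_nonneg_right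
        (mul_nonneg h₁.le (by linarith)))]
      field_simp
      ring
    rw [e₁, e₂, kinkOrderIso_of_ge h₃ (le_add_of_nonneg_right
      (mul_nonneg (by positivity) (by linarith)))]
    field_simp
    ring
  · simp only [OrderIso.trans_apply]
    have e₁ : kinkOrderIso δ _ h₁ a = b := by
      rw [kinkOrderIso_of_ge h₁ ha.le]
      field_simp
      ring
    rw [e₁, kinkOrderIso_of_le h₂ le_rfl, kinkOrderIso_of_le h₃ hbR.le]

section Radial

variable {E : Type*} [NormedAddCommGroup E] [NormedSpace ℝ E]

theorem norm_radial_smul {u : ℝ ≃o ℝ} (h0 : u 0 = 0) (x : E) :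
    ‖(u ‖x‖ / ‖x‖) • x‖ = u ‖x‖ := by
  rcases eq_or_ne x 0 with rfl | hx
  · simp [h0]
  · have hu : 0 ≤ u ‖x‖ := h0 ▸ u.monotone (norm_nonneg x)
    have : ‖x‖ ≠ 0 := norm_ne_zero_iff.2 hx
    rw [norm_smul, norm_div, norm_norm, Real.norm_of_nonneg hu]
    field_simp

theorem continuous_radial_smul {u : ℝ ≃o ℝ} {δ : ℝ} (hδ : 0 < δ) (hu : ∀ t ≤ δ, u t = t) :
    Continuous fun x : E => (u ‖x‖ / ‖x‖) • x := by
  rw [continuous_iff_continuousAt]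
  intro x
  rcases eq_or_ne x 0 with rfl | hx
  · refine continuousAt_id.congr ?_
    filter_upwards [ball_mem_nhds (0 : E) hδ] with y hy
    rcases eq_or_ne y 0 with rfl | hy0
    · simp
    · have : ‖y‖ ≠ 0 := norm_ne_zero_iff.2 hy0
      rw [hu _ (mem_ball_zero_iff.1 hy).le, div_self this, one_smul, id]
  · exact ((u.continuous.continuousAt.comp continuous_norm.continuousAt).div
      continuous_norm.continuousAt (norm_ne_zero_iff.2 hx)).smul continuousAt_id

theorem radial_smul_leftInverse {u v : ℝ ≃o ℝ} (h0 : u 0 = 0) (huv : ∀ t, v (u t) = t) (x : E) :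
    (v ‖(u ‖x‖ / ‖x‖) • x‖ / ‖(u ‖x‖ / ‖x‖) • x‖) • (u ‖x‖ / ‖x‖) • x = x := by
  rw [norm_radial_smul h0, huv]
  rcases eq_or_ne x 0 with rfl | hx
  · simp
  · have h1 : ‖x‖ ≠ 0 := norm_ne_zero_iff.2 hx
    have h2 : u ‖x‖ ≠ 0 := fun h => h1 (u.injective (h.trans h0.symm))
    rw [smul_smul, div_mul_div_cancel₀ h2, div_self h1, one_smul]

/-- A radial homeomorphism carrying one ball onto another, which is the identity near the origin
and far from the origin. -/
theorem exists_homeomorph_ball_ball {δ a b R : ℝ} (hδ : 0 < δ) (ha : δ < a) (hb : δ < b)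
    (haR : a < R) (hbR : b < R) :
    ∃ H : E ≃ₜ E, (∀ x, ‖x‖ ≤ δ → H x = x) ∧ (∀ x, R ≤ ‖x‖ → H x = x) ∧
      ∀ x, ‖H x‖ < b ↔ ‖x‖ < a := by
  obtain ⟨u, hu1, hu2, hu3⟩ := exists_orderIso_real_eq_id_off_Icc ha hb haR hbR
  have h0 : u 0 = 0 := hu1 0 hδ.le
  have h0' : u.symm 0 = 0 := by rw [← h0, u.symm_apply_apply, h0]
  have hv : ∀ t ≤ δ, u.symm t = t := fun t ht => by
    rw [OrderIso.symm_apply_eq, hu1 t ht]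
  have key : ∀ x : E, u ‖x‖ = ‖x‖ → (u ‖x‖ / ‖x‖) • x = x := by
    intro x hx
    rcases eq_or_ne x 0 with rfl | hx0
    · simp
    · rw [hx, div_self (norm_ne_zero_iff.2 hx0), one_smul]
  refine ⟨{ toFun := fun x => (u ‖x‖ / ‖x‖) • x
            invFun := fun x => (u.symm ‖x‖ / ‖x‖) • x
            left_inv := radial_smul_leftInverse h0 u.symm_apply_apply
            right_inv := radial_smul_leftInverse h0' u.apply_symm_apply
            continuous_toFun := continuous_radial_smul hδ hu1
            continuous_invFun := continuous_radial_smul hδ hv },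
    fun x hx => key x (hu1 _ hx), fun x hx => key x (hu2 _ hx), fun x => ?_⟩
  change ‖(u ‖x‖ / ‖x‖) • x‖ < b ↔ _
  rw [norm_radial_smul h0, ← hu3, u.lt_iff_lt]

end Radial

section Extension

variable {E P : Type*} [TopologicalSpace E] [TopologicalSpace P] [T2Space P]

theorem continuous_viaEmbedding {f : E → P} (hf : IsOpenEmbedding f) {C : Set E}
    (hC : IsCompact C) {ρ : Equiv.Perm E} (hρ : Continuous ρ) (hid : ∀ x ∉ C, ρ x = x) :
    Continuous (ρ.viaEmbedding ⟨f, hf.injective⟩) := by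
  rw [continuous_iff_continuousAt]
  intro p
  by_cases hp : p ∈ range f
  · obtain ⟨x, rfl⟩ := hp
    rw [← hf.continuousAt_iff]
    have : ρ.viaEmbedding ⟨f, hf.injective⟩ ∘ f = f ∘ ρ :=
      funext fun y => Equiv.Perm.viaEmbedding_apply ρ ⟨f, hf.injective⟩ y
    rw [this]
    exact (hf.continuous.comp hρ).continuousAt
  · refine continuousAt_id.congr ?_
    filter_upwards [(hC.image hf.continuous).isClosed.isOpen_compl.mem_nhds
      fun h => hp (image_subset_range _ _ h)] with q hq
    by_cases hq' : q ∈ range f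
    · obtain ⟨x, rfl⟩ := hq'
      refine ((Equiv.Perm.viaEmbedding_apply ρ ⟨f, hf.injective⟩ x).trans ?_).symm
      exact congrArg f (hid x fun hx => hq (mem_image_of_mem f hx))
    · exact (Equiv.Perm.viaEmbedding_apply_of_notMem ρ ⟨f, hf.injective⟩ q hq').symm

/-- A compactly supported homeomorphism extends along an open embedding into a Hausdorff space. -/
theorem exists_homeomorph_extend {f : E → P} (hf : IsOpenEmbedding f) {C : Set E}
    (hC : IsCompact C) (ρ : E ≃ₜ E) (hid : ∀ x ∉ C, ρ x = x) :
    ∃ A : P ≃ₜ P, (∀ x, A (f x) = f (ρ x)) ∧ ∀ p ∉ range f, A p = p := by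
  have hinv : ∀ x ∉ C, ρ.symm x = x := fun x hx => by
    rw [Homeomorph.symm_apply_eq, hid x hx]
  let ι : E ↪ P := ⟨f, hf.injective⟩
  refine ⟨{ toEquiv := Equiv.Perm.viaEmbedding ρ.toEquiv ι
            continuous_toFun := continuous_viaEmbedding hf hC ρ.continuous hid
            continuous_invFun := ?_ },
    fun x => Equiv.Perm.viaEmbedding_apply ρ.toEquiv ι x,
    fun p hp => Equiv.Perm.viaEmbedding_apply_of_notMem ρ.toEquiv ι p hp⟩
  have : (Equiv.Perm.viaEmbedding ρ.toEquiv ι).symm = Equiv.Perm.viaEmbedding ρ.symm.toEquiv ι :=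
    (map_inv (Equiv.Perm.viaEmbeddingHom ι) ρ.toEquiv).symm
  change Continuous (Equiv.Perm.viaEmbedding ρ.toEquiv ι).symm
  rw [this]
  exact continuous_viaEmbedding hf hC ρ.symm.continuous hinv

end Extension

section Engulfing

variable {E P : Type*} [NormedAddCommGroup E] [NormedSpace ℝ E] [ProperSpace E]
  [TopologicalSpace P] [T2Space P]

/-- If a chart `g` contains `K` and a ball of the chart `f`, then an ambient homeomorphism fixing a
smaller ball of `f` pushes the larger ball over `K`. -/
theorem exists_homeomorph_engulf {f g : E → P} (hf : IsOpenEmbedding f) (hg : IsOpenEmbedding g)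
    {r R : ℝ} (hr : 0 < r) (hrR : r < R) {K : Set P} (hK : IsCompact K) (hKg : K ⊆ range g)
    (hfg : f '' closedBall 0 R ⊆ range g) :
    ∃ A : P ≃ₜ P, (∀ x ∈ ball (0 : E) r, A (f x) = f x) ∧ K ⊆ (A ∘ f) '' ball 0 R := by
  wlog h0 : g 0 = f 0 generalizing g
  · obtain ⟨y, hy⟩ := hfg (mem_image_of_mem f (mem_closedBall_self (hr.trans hrR).le))
    have hrange : range (g ∘ Homeomorph.addRight y) = range g :=
      (Homeomorph.addRight y).surjective.range_comp g
    exact this (hg.comp (Homeomorph.addRight y).isOpenEmbedding) (hrange ▸ hKg) (hrange ▸ hfg)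
      (by simpa using hy)
  obtain ⟨ε, hε, hεR⟩ : ∃ ε > 0, ball (0 : E) ε ⊆ g ⁻¹' (f '' ball 0 R) :=
    Metric.mem_nhds_iff.1 (hg.continuous.continuousAt.preimage_mem_nhds
      (h0 ▸ hf.image_mem_nhds.2 (ball_mem_nhds 0 (hr.trans hrR))))
  obtain ⟨η, hη, hηε⟩ : ∃ η > 0, ball (0 : E) η ⊆ f ⁻¹' (g '' ball 0 (ε / 2)) :=
    Metric.mem_nhds_iff.1 (hf.continuous.continuousAt.preimage_mem_nhds
      (h0 ▸ hg.image_mem_nhds.2 (ball_mem_nhds 0 (half_pos hε))))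
  have hm : 0 < min η r := lt_min hη hr
  have hmr := min_le_right η r
  obtain ⟨ρ, -, hρR, hρ⟩ := exists_homeomorph_ball_ball (E := E) (δ := min η r / 2) (a := r)
    (b := min η r) (R := R) (by linarith) (by linarith) (by linarith) hrR (by linarith)
  obtain ⟨θ, hθ, hθid⟩ := exists_homeomorph_extend hf (isCompact_closedBall (0 : E) R) ρ
    fun x hx => hρR x (by simpa using (not_le.1 fun h => hx (by simpa using h)).le)
  have hρle : ∀ x, ‖x‖ ≤ R → ‖ρ x‖ ≤ R := fun x hx => by
    by_contra! h
    have := ρ.injective (hρR _ h.le)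
    rw [this] at h
    exact absurd hx h.not_ge
  have hθK : θ '' K ⊆ range g := by
    rintro _ ⟨p, hp, rfl⟩
    by_cases hpf : p ∈ range f
    · obtain ⟨x, rfl⟩ := hpf
      rw [hθ]
      rcases le_total ‖x‖ R with h | h
      · exact hfg (mem_image_of_mem f (by simpa using hρle x h))
      · rw [hρR x h]
        exact hKg hp
    · rw [hθid p hpf]
      exact hKg hp
  obtain ⟨M, hMε, hM⟩ : ∃ M > ε, g ⁻¹' (θ '' K) ⊆ ball 0 M :=
    (hg.isInducing.isCompact_preimage' (hK.image θ.continuous) hθK).isBounded.subset_ball_lt ε 0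
  obtain ⟨σ, hσε, hσM, hσ⟩ := exists_homeomorph_ball_ball (E := E) (δ := ε / 2) (a := ε)
    (b := M) (R := M + 1) (by linarith) (by linarith) (by linarith) (by linarith) (by linarith)
  obtain ⟨S, hS, -⟩ := exists_homeomorph_extend hg (isCompact_closedBall (0 : E) (M + 1)) σ
    fun x hx => hσM x (by simpa using (not_le.1 fun h => hx (by simpa using h)).le)
  refine ⟨(θ.trans S).trans θ.symm, fun x hx => ?_, fun p hp => ?_⟩
  · obtain ⟨w, hw, hwx⟩ : f (ρ x) ∈ g '' ball 0 (ε / 2) :=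
      hηε (mem_ball_zero_iff.2 (((hρ x).2 (mem_ball_zero_iff.1 hx)).trans_le (min_le_left _ _)))
    simp only [Homeomorph.trans_apply, Homeomorph.symm_apply_eq]
    rw [hθ, ← hwx, hS, hσε w (mem_ball_zero_iff.1 hw).le]
  · obtain ⟨z, hz⟩ := hθK (mem_image_of_mem θ hp)
    have hzM : ‖σ (σ.symm z)‖ < M := by
      rw [σ.apply_symm_apply]
      exact mem_ball_zero_iff.1 (hM (hz ▸ mem_image_of_mem θ hp : g z ∈ θ '' K))
    obtain ⟨y, hy, hyz⟩ := hεR (mem_ball_zero_iff.2 ((hσ _).1 hzM))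
    refine ⟨ρ.symm y, ?_, ?_⟩
    · rw [mem_ball_zero_iff] at hy ⊢
      by_contra! h
      have := hρR _ h
      rw [ρ.apply_symm_apply] at this
      rw [← this] at h
      exact absurd hy h.not_gt
    · simp only [Function.comp, Homeomorph.trans_apply, Homeomorph.symm_apply_eq]
      rw [hθ, ρ.apply_symm_apply, hyz, hS, σ.apply_symm_apply, hz]

theorem exists_isOpenEmbedding_engulf
    (h : ∀ X : Set P, IsCompact X → ∃ g : E → P, IsOpenEmbedding g ∧ X ⊆ range g)
    {f : E → P} (hf : IsOpenEmbedding f) {r R : ℝ} (hr : 0 < r) (hrR : r < R) {K : Set P}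
    (hK : IsCompact K) :
    ∃ f' : E → P, IsOpenEmbedding f' ∧ EqOn f' f (ball 0 r) ∧ K ⊆ f' '' ball 0 R := by
  obtain ⟨g, hg, hsub⟩ := h (K ∪ f '' closedBall 0 R)
    (hK.union ((isCompact_closedBall 0 R).image hf.continuous))
  obtain ⟨A, hA, hKA⟩ := exists_homeomorph_engulf hf hg hr hrR hK
    (subset_union_left.trans hsub) (subset_union_right.trans hsub)
  exact ⟨A ∘ f, A.isOpenEmbedding.comp hf, hA, hKA⟩

/-- Open embeddings that stabilise on the balls of integer radius glue to an open embedding. -/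
theorem exists_isOpenEmbedding_of_eqOn_ball {E P : Type*} [NormedAddCommGroup E]
    [TopologicalSpace P] {f : ℕ → E → P} (hf : ∀ m, IsOpenEmbedding (f m))
    (hstep : ∀ m : ℕ, EqOn (f (m + 1)) (f m) (ball 0 (m + 1))) :
    ∃ F : E → P, IsOpenEmbedding F ∧ ∀ m : ℕ, EqOn F (f m) (ball 0 (m + 1)) := by
  have hle : ∀ N m : ℕ, N ≤ m → EqOn (f m) (f N) (ball 0 (N + 1)) := by
    intro N m hNm
    induction m, hNm using Nat.le_induction with
    | base => exact eqOn_refl _ _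
    | succ m hm ih =>
      refine EqOn.trans ((hstep m).mono (ball_subset_ball ?_)) ih
      gcongr
  let F : E → P := fun x => f ⌊‖x‖⌋₊ x
  have hF : ∀ m : ℕ, EqOn F (f m) (ball 0 (m + 1)) := fun m x hx => by
    refine (hle _ m ?_ (mem_ball_zero_iff.2 (Nat.lt_floor_add_one ‖x‖))).symm
    have : ⌊‖x‖⌋₊ < m + 1 := (Nat.floor_lt (norm_nonneg x)).2 (by
      push_cast
      exact mem_ball_zero_iff.1 hx)
    omega
  have hev : ∀ x, F =ᶠ[𝓝 x] f ⌊‖x‖⌋₊ := fun x =>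
    (hF _).eventuallyEq_of_mem (isOpen_ball.mem_nhds
      (mem_ball_zero_iff.2 (Nat.lt_floor_add_one ‖x‖)))
  refine ⟨F, .of_continuous_injective_isOpenMap ?_ ?_ ?_, hF⟩
  · exact continuous_iff_continuousAt.2 fun x =>
      (hf _).continuous.continuousAt.congr (hev x).symm
  · intro x y hxy
    have hmem : ∀ z : E, ‖z‖ ≤ max ‖x‖ ‖y‖ → z ∈ ball (0 : E) (⌊max ‖x‖ ‖y‖⌋₊ + 1) := fun z hz =>
      mem_ball_zero_iff.2 (hz.trans_lt (Nat.lt_floor_add_one _))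
    rw [hF _ (hmem x (le_max_left _ _)), hF _ (hmem y (le_max_right _ _))] at hxy
    exact (hf _).injective hxy
  · refine isOpenMap_iff_nhds_le.2 fun x => ?_
    rw [Filter.map_congr (hev x)]
    exact (hf _).isOpenMap.nhds_le x

theorem nonempty_homeomorph_of_engulfing [SigmaCompactSpace P]
    (h : ∀ X : Set P, IsCompact X → ∃ g : E → P, IsOpenEmbedding g ∧ X ⊆ range g) :
    Nonempty (P ≃ₜ E) := by
  choose! next hnext using fun (m : ℕ) (f : E → P) (hf : IsOpenEmbedding f) =>
    exists_isOpenEmbedding_engulf h hf (r := m + 1) (R := m + 2) (by positivity) (by linarith)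
      (isCompact_compactCovering P m)
  obtain ⟨f₀, hf₀, -⟩ := h ∅ isCompact_empty
  let f : ℕ → E → P := fun m => Nat.rec f₀ next m
  have hf : ∀ m, IsOpenEmbedding (f m) := fun m => by
    induction m with
    | zero => exact hf₀
    | succ m ih => exact (hnext m _ ih).1
  obtain ⟨F, hFemb, hF⟩ := exists_isOpenEmbedding_of_eqOn_ball hf
    fun m => (hnext m _ (hf m)).2.1
  have hsurj : Function.Surjective F := fun p => by
    obtain ⟨m, hm⟩ := exists_mem_compactCovering p
    obtain ⟨y, hy, hyp⟩ := (hnext m _ (hf m)).2.2 hm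
    refine ⟨y, (hF (m + 1) ?_).trans hyp⟩
    convert hy using 2
    push_cast
    ring
  exact ⟨(hFemb.toIsEmbedding.toHomeomorphOfSurjective hsurj).symm⟩

end Engulfing

/-- **Folklore engulfing lemma** (in the spirit of Stallings).
Let `n ≥ 1` and let `P` be a nonempty σ-compact Hausdorff topological space. Suppose that
for every compact subset `X` of `P` there is an open topological embedding
`f : ℝⁿ → P` such that `X ⊆ f(ℝⁿ)`. Then `P` is homeomorphic to `ℝⁿ`. -/
theorem engulfing_lemma (n : ℕ) (hn : 1 ≤ n)
    (P : Type) [TopologicalSpace P] [T2Space P] [Nonempty P] [SigmaCompactSpace P]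
    (h : ∀ X : Set P, IsCompact X →
      ∃ f : EuclideanSpace ℝ (Fin n) → P, Topology.IsOpenEmbedding f ∧ X ⊆ Set.range f) :
    Nonempty (P ≃ₜ EuclideanSpace ℝ (Fin n)) := by
  exact nonempty_homeomorph_of_engulfing h
end

section
/- Let n ≥ 1 and let M be a Hausdorff topological space which is the union of an increasing sequence U₁ ⊆ U₂ ⊆ U₃ ⊆ … of open subsets, each of which is homeomorphic to ℝⁿ. Then M is homeomorphic to ℝⁿ. -/
open Set Filter Topology Metric

/-- A point of an interval can be moved to any other point of it by an increasing
homeomorphism of the line which is the identity outside the interval. -/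
theorem exists_orderIso_eqOn_compl_Ioo {a b c d : ℝ} (ha : a ∈ Ioo c d) (hb : b ∈ Ioo c d) :
    ∃ e : ℝ ≃o ℝ, e a = b ∧ EqOn e id (Ioo c d)ᶜ := by
  wlog hab : b ≤ a generalizing a b
  · obtain ⟨e, he, hid⟩ := this hb ha (le_of_not_ge hab)
    refine ⟨e.symm, by simp [← he], fun t ht => ?_⟩
    rw [OrderIso.symm_apply_eq]
    exact (hid ht).symm
  obtain ⟨hca, had⟩ := ha
  obtain ⟨hcb, hbd⟩ := hb
  have hs : 0 < (b - c) / (a - c) := div_pos (by linarith) (by linarith)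
  have hs' : (b - c) / (a - c) ≤ 1 := by rw [div_le_one (by linarith)]; linarith
  have hsa : (b - c) / (a - c) * (a - c) = b - c := div_mul_cancel₀ _ (by linarith)
  have hu : 1 ≤ (d - b) / (d - a) := by rw [one_le_div (by linarith)]; linarith
  have hua : (d - b) / (d - a) * (d - a) = d - b := div_mul_cancel₀ _ (by linarith)
  generalize (b - c) / (a - c) = s at *
  generalize (d - b) / (d - a) = u at *
  let m : ℝ → ℝ := fun t => min t (max (c + s * (t - c)) (d + u * (t - d)))
  have hm : StrictMono m := by
    intro x y hxy
    have h1 : c + s * (x - c) < c + s * (y - c) := by nlinarith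
    have h2 : d + u * (x - d) < d + u * (y - d) := by nlinarith
    exact min_lt_min hxy (max_lt_max h1 h2)
  have hle : ∀ t ≤ c, m t = t := fun t ht =>
    min_eq_left (le_max_of_le_left (by nlinarith))
  have hge : ∀ t ≥ d, m t = t := fun t ht =>
    min_eq_left (le_max_of_le_right (by nlinarith))
  have hcont : Continuous m := by fun_prop
  have hsurj : Function.Surjective m := by
    refine hcont.surjective ?_ ?_
    · exact tendsto_id.congr' ((eventually_ge_atTop d).mono fun t ht => (hge t ht).symm)
    · exact tendsto_id.congr' ((eventually_le_atBot c).mono fun t ht => (hle t ht).symm)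
  refine ⟨hm.orderIsoOfSurjective m hsurj, ?_, fun t ht => ?_⟩
  · have h1 : c + s * (a - c) = b := by linarith
    have h2 : d + u * (a - d) = b := by linarith
    simp [m, h1, h2, hab]
  · rw [mem_compl_iff, mem_Ioo, not_and_or, not_lt, not_lt] at ht
    exact ht.elim (hle t) (hge t)

section Radial

variable {E : Type*} [NormedAddCommGroup E] [NormedSpace ℝ E]

/-- The map that preserves rays from `p` and acts on the distance to `p` by `m`. -/
noncomputable def radialMap (p : E) (m : ℝ → ℝ) (x : E) : E :=
  p + (m ‖x - p‖ / ‖x - p‖) • (x - p)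

theorem radialMap_eq_self {p : E} {m : ℝ → ℝ} {x : E} (h : m ‖x - p‖ = ‖x - p‖) :
    radialMap p m x = x := by
  rcases eq_or_ne (x - p) 0 with h0 | h0
  · rw [radialMap, h0, smul_zero, add_zero, sub_eq_zero.1 h0]
  · rw [radialMap, h, div_self (norm_ne_zero_iff.2 h0), one_smul, add_sub_cancel]

theorem norm_radialMap_sub {p : E} {m : ℝ → ℝ} (hm : Monotone m) (h0 : m 0 = 0) (x : E) :
    ‖radialMap p m x - p‖ = m ‖x - p‖ := by
  have hn : 0 ≤ m ‖x - p‖ := h0 ▸ hm (norm_nonneg _)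
  rcases eq_or_ne (x - p) 0 with hx | hx
  · simp [radialMap, hx, h0]
  · rw [radialMap, add_sub_cancel_left, norm_smul, norm_div, norm_norm, Real.norm_of_nonneg hn,
      div_mul_cancel₀ _ (norm_ne_zero_iff.2 hx)]

theorem radialMap_radialMap {p : E} {m m' : ℝ → ℝ} (hm : Monotone m) (h0 : m 0 = 0)
    (hinj : Function.Injective m) (hinv : Function.LeftInverse m' m) (x : E) :
    radialMap p m' (radialMap p m x) = x := by
  rcases eq_or_ne (x - p) 0 with hx | hx
  · rw [sub_eq_zero.1 hx]
    simp [radialMap]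
  · have hx' : ‖x - p‖ ≠ 0 := norm_ne_zero_iff.2 hx
    have hmx : m ‖x - p‖ ≠ 0 := fun h => hx' (hinj (h.trans h0.symm))
    have key := norm_radialMap_sub (p := p) hm h0 x
    rw [radialMap, key, hinv, radialMap, add_sub_cancel_left, smul_smul,
      div_mul_div_cancel₀ hmx, div_self hx', one_smul, add_sub_cancel]

theorem continuous_radialMap {p : E} {m : ℝ → ℝ} (hm : Monotone m) (h0 : m 0 = 0)
    (hc : Continuous m) : Continuous (radialMap p m) := by
  rw [continuous_iff_continuousAt]
  intro x
  rcases eq_or_ne x p with rfl | hx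
  · have hxx : radialMap x m x = x := by simp [radialMap]
    rw [ContinuousAt, hxx, tendsto_iff_norm_sub_tendsto_zero]
    simp_rw [norm_radialMap_sub hm h0]
    have : Continuous fun y => m ‖y - x‖ := by fun_prop
    simpa [h0] using this.tendsto x
  · have hx' : ‖x - p‖ ≠ 0 := norm_ne_zero_iff.2 (sub_ne_zero.2 hx)
    unfold radialMap
    fun_prop (disch := assumption)

/-- The homeomorphism that preserves rays from `p` and acts on the distance to `p` by `e`. -/
noncomputable def radialHomeomorph (p : E) (e : ℝ ≃o ℝ) (h0 : e 0 = 0) : E ≃ₜ E where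
  toFun := radialMap p e
  invFun := radialMap p e.symm
  left_inv := radialMap_radialMap e.monotone h0 e.injective e.symm_apply_apply
  right_inv := radialMap_radialMap e.symm.monotone (by simp [OrderIso.symm_apply_eq, h0])
    e.symm.injective e.apply_symm_apply
  continuous_toFun := continuous_radialMap e.monotone h0 e.continuous
  continuous_invFun := continuous_radialMap e.symm.monotone
    (by simp [OrderIso.symm_apply_eq, h0]) e.symm.continuous

/-- Concentric balls can be stretched or shrunk onto each other by a homeomorphism which is the
identity near the centre and away from it. -/
theorem exists_homeomorph_image_closedBall (p : E) {a b c d : ℝ} (hc : 0 ≤ c)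
    (ha : a ∈ Ioo c d) (hb : b ∈ Ioo c d) :
    ∃ θ : E ≃ₜ E, θ '' closedBall p a = closedBall p b ∧
      EqOn θ id (closedBall p c) ∧ EqOn θ id (ball p d)ᶜ := by
  obtain ⟨e, hab, hid⟩ := exists_orderIso_eqOn_compl_Ioo ha hb
  have h0 : e 0 = 0 := hid fun h => h.1.not_ge hc
  have hnorm (x : E) : ‖radialHomeomorph p e h0 x - p‖ = e ‖x - p‖ :=
    norm_radialMap_sub e.monotone h0 x
  refine ⟨radialHomeomorph p e h0, ?_, fun x hx => ?_, fun x hx => ?_⟩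
  · ext y
    obtain ⟨x, rfl⟩ := (radialHomeomorph p e h0).surjective y
    rw [(radialHomeomorph p e h0).injective.mem_set_image, mem_closedBall_iff_norm,
      mem_closedBall_iff_norm, hnorm, ← hab, e.le_iff_le]
  · rw [mem_closedBall_iff_norm] at hx
    exact radialMap_eq_self (hid fun h => h.1.not_ge hx)
  · rw [mem_compl_iff, mem_ball_iff_norm, not_lt] at hx
    exact radialMap_eq_self (hid fun h => h.2.not_ge hx)

end Radial

theorem extend_comp_id_leftInverse {X Y : Type*} {f : X → Y} (hf : Function.Injective f)
    {ψ ψ' : X → X} (h : Function.LeftInverse ψ' ψ) :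
    Function.LeftInverse (Function.extend f (f ∘ ψ') id) (Function.extend f (f ∘ ψ) id) := by
  intro y
  by_cases hy : y ∈ range f
  · obtain ⟨x, rfl⟩ := hy
    simp [hf.extend_apply, h x]
  · rw [Function.extend_apply' (f ∘ ψ) _ _ hy, id, Function.extend_apply' _ _ _ hy, id]

section Extend

variable {X Y : Type*} [TopologicalSpace X] [TopologicalSpace Y] [T2Space Y]

theorem continuous_extend_comp_id {f : X → Y} (hf : IsOpenEmbedding f) {ψ : X → X}
    (hψ : Continuous ψ) {K : Set X} (hK : IsCompact K) (hid : EqOn ψ id Kᶜ) :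
    Continuous (Function.extend f (f ∘ ψ) id) := by
  rw [continuous_iff_continuousAt]
  intro y
  by_cases hy : y ∈ range f
  · obtain ⟨x, rfl⟩ := hy
    rw [← hf.continuousAt_iff, Function.extend_comp hf.injective]
    exact (hf.continuous.comp hψ).continuousAt
  · have hyK : y ∈ (f '' K)ᶜ := fun h => hy (image_subset_range f K h)
    refine continuousAt_id.congr ?_
    filter_upwards [(hK.image hf.continuous).isClosed.isOpen_compl.mem_nhds hyK] with z hz
    by_cases hzr : z ∈ range f
    · obtain ⟨x, rfl⟩ := hzr
      rw [hf.injective.extend_apply, Function.comp_apply, hid fun h => hz (mem_image_of_mem f h)]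
      rfl
    · rw [Function.extend_apply' _ _ _ hzr]

/-- A compactly supported homeomorphism of an open subspace extends by the identity. -/
theorem Topology.IsOpenEmbedding.exists_homeomorph_extend {f : X → Y} (hf : IsOpenEmbedding f)
    (ψ : X ≃ₜ X) {K : Set X} (hK : IsCompact K) (hid : EqOn ψ id Kᶜ) :
    ∃ φ : Y ≃ₜ Y, (∀ x, φ (f x) = f (ψ x)) ∧ EqOn φ id (f '' K)ᶜ := by
  have hid' : EqOn ψ.symm id Kᶜ := fun x hx => by
    rw [ψ.symm_apply_eq]
    exact (hid hx).symm
  refine ⟨⟨⟨Function.extend f (f ∘ ψ) id, Function.extend f (f ∘ ψ.symm) id,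
    extend_comp_id_leftInverse hf.injective ψ.symm_apply_apply,
    extend_comp_id_leftInverse hf.injective ψ.apply_symm_apply⟩,
    continuous_extend_comp_id hf ψ.continuous hK hid,
    continuous_extend_comp_id hf ψ.symm.continuous hK hid'⟩,
    fun x => hf.injective.extend_apply _ _ x, fun y hy => ?_⟩
  change Function.extend f (f ∘ ψ) id y = y
  by_cases hyr : y ∈ range f
  · obtain ⟨x, rfl⟩ := hyr
    rw [hf.injective.extend_apply, Function.comp_apply, hid fun h => hy (mem_image_of_mem f h)]
    rfl
  · rw [Function.extend_apply' _ _ _ hyr, id]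

end Extend

section Engulfing

variable {E : Type*} [NormedAddCommGroup E] [NormedSpace ℝ E] [ProperSpace E]

/-- An open embedding of `E` into itself can be changed outside a ball so that the image of a
larger ball engulfs a given compact set. -/
theorem Topology.IsOpenEmbedding.exists_engulf_self {f : E → E} (hf : IsOpenEmbedding f)
    {r s : ℝ} (hr : 0 < r) (hrs : r < s) {C : Set E} (hC : IsCompact C) :
    ∃ F : E → E, IsOpenEmbedding F ∧ EqOn F f (closedBall 0 r) ∧ C ⊆ F '' closedBall 0 s := by
  have hs : 0 < s := hr.trans hrs
  have hK : IsCompact (closedBall (0 : E) s) := isCompact_closedBall 0 s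
  obtain ⟨ε, hε, hεf⟩ : ∃ ε > 0, closedBall (f 0) ε ⊆ f '' closedBall 0 s :=
    nhds_basis_closedBall.mem_iff.1
      (hf.isOpenMap.image_mem_nhds (closedBall_mem_nhds 0 hs))
  obtain ⟨δ, hδ, hδf⟩ : ∃ δ > 0, closedBall 0 δ ⊆ f ⁻¹' closedBall (f 0) (ε / 2) :=
    nhds_basis_closedBall.mem_iff.1
      (hf.continuous.continuousAt (closedBall_mem_nhds (f 0) (half_pos hε)))
  obtain ⟨R, hεR, hR⟩ : ∃ R > ε / 2, C ∪ f '' closedBall 0 s ⊆ closedBall (f 0) R :=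
    (hC.union (hK.image hf.continuous)).isBounded.subset_closedBall_lt _ _
  obtain ⟨ψ, hψr, -, hψs⟩ := exists_homeomorph_image_closedBall (0 : E) le_rfl
    (show r ∈ Ioo 0 s from ⟨hr, hrs⟩)
    (show min δ r ∈ Ioo 0 s from ⟨lt_min hδ hr, (min_le_right _ _).trans_lt hrs⟩)
  have hψK : EqOn ψ id (closedBall 0 s)ᶜ :=
    hψs.mono (compl_subset_compl.2 ball_subset_closedBall)
  obtain ⟨φ, hφf, hφK⟩ := hf.exists_homeomorph_extend ψ hK hψK
  obtain ⟨θ, hθε, hθc, -⟩ := exists_homeomorph_image_closedBall (f 0) (half_pos hε).le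
    (show ε ∈ Ioo (ε / 2) (max ε R + 1) from
      ⟨half_lt_self hε, (le_max_left _ _).trans_lt (lt_add_one _)⟩)
    (show R ∈ Ioo (ε / 2) (max ε R + 1) from ⟨hεR, (le_max_right _ _).trans_lt (lt_add_one _)⟩)
  have hmapsTo {x : E} (hx : ψ x ∈ closedBall 0 s) : x ∈ closedBall 0 s := by
    by_contra h
    rw [hψK h] at hx
    exact h hx
  have hmapsTo' {x : E} (hx : x ∈ closedBall 0 s) : ψ x ∈ closedBall 0 s := by
    by_contra h
    exact h (by rwa [ψ.injective (hψK h)])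
  refine ⟨φ.symm ∘ θ ∘ φ ∘ f, ?_, fun x hx => ?_, fun y hy => ?_⟩
  · exact φ.symm.isOpenEmbedding.comp (θ.isOpenEmbedding.comp (φ.isOpenEmbedding.comp hf))
  · have hψx : ψ x ∈ closedBall 0 δ :=
      closedBall_subset_closedBall (min_le_left _ _) (hψr ▸ mem_image_of_mem ψ hx)
    have hθx : θ (f (ψ x)) = f (ψ x) := hθc (hδf hψx)
    simp only [Function.comp_apply]
    rw [φ.symm_apply_eq, hφf, hθx]
  · have hφy : φ y ∈ closedBall (f 0) R := by
      by_cases h : y ∈ f '' closedBall 0 s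
      · obtain ⟨x, hx, rfl⟩ := h
        rw [hφf]
        exact hR (Or.inr (mem_image_of_mem f (hmapsTo' hx)))
      · rw [hφK h]
        exact hR (Or.inl hy)
    rw [← hθε] at hφy
    obtain ⟨z, hz, hzy⟩ := hφy
    obtain ⟨x, hx, rfl⟩ := hεf hz
    refine ⟨ψ.symm x, hmapsTo (by rwa [ψ.apply_symm_apply]), ?_⟩
    simp only [Function.comp_apply]
    rw [hφf, ψ.apply_symm_apply, hzy, φ.symm_apply_apply]

variable {M : Type*} [TopologicalSpace M]

theorem Topology.IsOpenEmbedding.exists_engulf {f g : E → M} (hf : IsOpenEmbedding f)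
    (hg : IsOpenEmbedding g) (hfg : range f ⊆ range g) {r s : ℝ} (hr : 0 < r) (hrs : r < s)
    {C : Set M} (hC : IsCompact C) (hCg : C ⊆ range g) :
    ∃ F : E → M, IsOpenEmbedding F ∧ range F ⊆ range g ∧ EqOn F f (closedBall 0 r) ∧
      C ⊆ F '' closedBall 0 s := by
  choose f₀ hf₀ using fun x => hfg (mem_range_self x)
  obtain rfl : g ∘ f₀ = f := funext hf₀
  obtain ⟨F, hF, hFr, hFs⟩ := (IsOpenEmbedding.of_comp f₀ hg hf).exists_engulf_self hr hrs
    (hg.isInducing.isCompact_preimage' hC hCg)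
  refine ⟨g ∘ F, hg.comp hF, range_comp_subset_range F g, fun x hx => congrArg g (hFr hx), ?_⟩
  rw [image_comp, ← image_preimage_eq_of_subset hCg]
  exact image_mono hFs

/-- Open embeddings that stabilize on an exhaustion by balls, and whose images of these balls
cover, glue to a homeomorphism. -/
theorem nonempty_homeomorph_of_eqOn_closedBall {E M : Type*} [SeminormedAddCommGroup E]
    [TopologicalSpace M] {f : ℕ → E → M} (hf : ∀ i, IsOpenEmbedding (f i))
    (heq : ∀ i : ℕ, EqOn (f (i + 1)) (f i) (closedBall 0 (i + 1)))
    (hcov : ∀ y, ∃ i : ℕ, y ∈ f i '' closedBall 0 (i + 1)) : Nonempty (E ≃ₜ M) := by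
  have hstab {i j : ℕ} (hij : i ≤ j) : EqOn (f j) (f i) (closedBall 0 (i + 1)) := by
    induction j, hij using Nat.le_induction with
    | base => exact eqOn_refl _ _
    | succ j hij ih =>
      exact ((heq j).mono (closedBall_subset_closedBall (by gcongr))).trans ih
  let F : E → M := fun x => f ⌈‖x‖⌉₊ x
  have hF (i : ℕ) : EqOn F (f i) (closedBall 0 (i + 1)) := by
    intro x hx
    have hx' : x ∈ closedBall (0 : E) (⌈‖x‖⌉₊ + 1) := by
      rw [mem_closedBall_zero_iff]
      exact (Nat.le_ceil _).trans (lt_add_one _).le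
    rcases le_total i ⌈‖x‖⌉₊ with h | h
    · exact hstab h hx
    · exact (hstab h hx').symm
  have hnhds (x : E) : map F (𝓝 x) = 𝓝 (F x) := by
    have hx : ‖x‖ < ⌈‖x‖⌉₊ + 1 := (Nat.le_ceil _).trans_lt (lt_add_one _)
    have hev : F =ᶠ[𝓝 x] f ⌈‖x‖⌉₊ :=
      (hF _).eventuallyEq_of_mem (closedBall_mem_nhds_of_mem (mem_ball_zero_iff.2 hx))
    rw [map_congr hev, (hf _).map_nhds_eq]
  have hinj : Function.Injective F := by
    intro x y hxy
    have hmem {z : E} (hz : ‖z‖ ≤ max ‖x‖ ‖y‖) :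
        z ∈ closedBall (0 : E) (⌈max ‖x‖ ‖y‖⌉₊ + 1) := by
      rw [mem_closedBall_zero_iff]
      exact hz.trans ((Nat.le_ceil _).trans (lt_add_one _).le)
    rw [hF _ (hmem (le_max_left _ _)), hF _ (hmem (le_max_right _ _))] at hxy
    exact (hf _).injective hxy
  have hsurj : Function.Surjective F := by
    intro y
    obtain ⟨i, x, hx, rfl⟩ := hcov y
    exact ⟨x, hF i hx⟩
  exact ⟨(Equiv.ofBijective F ⟨hinj, hsurj⟩).toHomeomorphOfContinuousOpen
    (continuous_iff_continuousAt.2 fun x => (hnhds x).le)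
    (IsOpenMap.of_nhds_le fun x => (hnhds x).ge)⟩

/-- A monotone union of open cells is an open cell. -/
theorem nonempty_homeomorph_of_iUnion_range {g : ℕ → E → M} (hg : ∀ i, IsOpenEmbedding (g i))
    (hmono : Monotone fun i => range (g i)) (hcover : ⋃ i, range (g i) = univ) :
    Nonempty (E ≃ₜ M) := by
  let C : ℕ → Set M := fun i => ⋃ j ∈ Finset.range (i + 1), g j '' closedBall 0 i
  have hC (i : ℕ) : IsCompact (C i) :=
    (Finset.range (i + 1)).isCompact_biUnion fun j _ =>
      (isCompact_closedBall 0 _).image (hg j).continuous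
  have hCg (i : ℕ) : C i ⊆ range (g i) :=
    iUnion₂_subset fun j hj => (image_subset_range _ _).trans
      (hmono (Finset.mem_range_succ_iff.1 hj))
  have step (i : ℕ) (f : {f : E → M // IsOpenEmbedding f ∧ range f ⊆ range (g i)}) :
      ∃ F : {f : E → M // IsOpenEmbedding f ∧ range f ⊆ range (g (i + 1))},
        EqOn F.1 f.1 (closedBall 0 (i + 1)) ∧
          C (i + 1) ⊆ F.1 '' closedBall 0 ((i + 1 : ℕ) + 1) := by
    obtain ⟨F, hF, hFg, hFr, hFs⟩ := f.2.1.exists_engulf (hg (i + 1))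
      (f.2.2.trans (hmono i.le_succ)) (r := i + 1) (s := (i + 1 : ℕ) + 1)
      (by positivity) (by push_cast; linarith) (hC (i + 1)) (hCg (i + 1))
    exact ⟨⟨F, hF, hFg⟩, hFr, hFs⟩
  choose next hnext hnextC using step
  let f (i : ℕ) : {f : E → M // IsOpenEmbedding f ∧ range f ⊆ range (g i)} :=
    Nat.rec ⟨g 0, hg 0, Subset.rfl⟩ next i
  refine nonempty_homeomorph_of_eqOn_closedBall (f := fun i => (f i).1) (fun i => (f i).2.1)
    (fun i => hnext i (f i)) fun y => ?_
  obtain ⟨j, x, rfl⟩ := mem_iUnion.1 (hcover ▸ mem_univ y)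
  let i := max j ⌈‖x‖⌉₊
  refine ⟨i + 1, hnextC i (f i) (mem_iUnion₂.2 ⟨j, ?_, mem_image_of_mem _ ?_⟩)⟩
  · rw [Finset.mem_range_succ_iff]
    exact (le_max_left _ _).trans i.le_succ
  · rw [mem_closedBall_zero_iff]
    exact (Nat.le_ceil _).trans (Nat.cast_le.2 ((le_max_right _ _).trans i.le_succ))

end Engulfing

/-- **Increasing-union form of the engulfing lemma.**
Let `n ≥ 1` and let `M` be a Hausdorff topological space which is the union of an
increasing sequence `U₁ ⊆ U₂ ⊆ U₃ ⊆ …` of open subsets, each of which is homeomorphic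
to `ℝⁿ`. Then `M` is homeomorphic to `ℝⁿ`. -/
theorem increasing_union_of_euclidean (n : ℕ) (hn : 1 ≤ n)
    (M : Type) [TopologicalSpace M] [T2Space M]
    (U : ℕ → Set M) (hopen : ∀ i, IsOpen (U i)) (hmono : Monotone U)
    (hcover : ⋃ i, U i = Set.univ)
    (hhomeo : ∀ i, Nonempty (↥(U i) ≃ₜ EuclideanSpace ℝ (Fin n))) :
    Nonempty (M ≃ₜ EuclideanSpace ℝ (Fin n)) := by
  let h (i : ℕ) : EuclideanSpace ℝ (Fin n) ≃ₜ U i := (hhomeo i).some.symm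
  have hrange (i : ℕ) : range (Subtype.val ∘ h i) = U i := by
    rw [(h i).surjective.range_comp, Subtype.range_val]
  obtain ⟨e⟩ := nonempty_homeomorph_of_iUnion_range (g := fun i => Subtype.val ∘ h i)
    (fun i => (hopen i).isOpenEmbedding_subtypeVal.comp (h i).isOpenEmbedding)
    (by simpa only [hrange] using hmono) (by simpa only [hrange] using hcover)
  exact ⟨e.symm⟩
end
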